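/- For all n, l ≥ 1, the metric spaces (ℝⁿ, d_U) and (ℝˡ, d_{B(ℝˡ)}) are not quasi-isometric; that is, there exists no quasi-isometry from (ℝⁿ, d_U) to (ℝˡ, d_{B(ℝˡ)}). -/

import Mathlib

open Set Pointwise MeasureTheory
open scoped Classical

/-- A `Q`-chain of length `k` from `x` to `y`: a sequence `Q_{i₁}, …, Q_{i_k}` of members of the
covering with `x ∈ Q_{i₁}`, `y ∈ Q_{i_k}` and consecutive members intersecting. -/
def ChainExists {X I : Type*} (Q : I → Set X) (k : ℕ) (x y : X) : Prop :=
  ∃ (hk : 0 < k) (c : Fin k → I),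
    x ∈ Q (c ⟨0, hk⟩) ∧ y ∈ Q (c ⟨k - 1, Nat.sub_lt hk Nat.one_pos⟩) ∧
      ∀ (l : ℕ) (h : l + 1 < k),
        (Q (c ⟨l, by omega⟩) ∩ Q (c ⟨l + 1, h⟩)).Nonempty

/-- An admissible covering: a family of nonempty sets covering `X` such that the number of
neighbours of each member is uniformly bounded. -/
def IsAdmissibleCovering {X I : Type*} (Q : I → Set X) : Prop :=
  (∀ i, (Q i).Nonempty) ∧ (⋃ i, Q i) = Set.univ ∧
    ∃ N : ℕ, ∀ i, {j | (Q i ∩ Q j).Nonempty}.Finite ∧ {j | (Q i ∩ Q j).Nonempty}.ncard ≤ N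

/-- A concatenation: an admissible covering in which any two points are joined by a chain. -/
def IsConcatenation {X I : Type*} (Q : I → Set X) : Prop :=
  IsAdmissibleCovering Q ∧ ∀ x y : X, ∃ k : ℕ, ChainExists Q k x y

/-- The associated metric `d_Q` of a covered space `(X, Q)`. -/
noncomputable def coveredDist {X I : Type*} (Q : I → Set X) (x y : X) : ℝ :=
  if x = y then 0 else ((sInf {k : ℕ | ChainExists Q k x y} : ℕ) : ℝ)

/-- Quasi-isometric embedding between (abstract) metric spaces. -/
def IsQIEmbedding {X Z : Type*} (dX : X → X → ℝ) (dZ : Z → Z → ℝ) (f : X → Z) : Prop :=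
  ∃ L C : ℝ, 0 < L ∧ 0 < C ∧ ∀ x y : X,
    (1 / L) * dX x y - C ≤ dZ (f x) (f y) ∧ dZ (f x) (f y) ≤ L * dX x y + C

/-- Quasi-isometry: a quasi-isometric embedding whose image is a net. -/
def IsQuasiIsometry {X Z : Type*} (dX : X → X → ℝ) (dZ : Z → Z → ℝ) (f : X → Z) : Prop :=
  IsQIEmbedding dX dZ f ∧ ∃ M : ℝ, 0 < M ∧ ∀ z : Z, ∃ x : X, dZ z (f x) ≤ M

/-- The iterated neighbourhood `P_j^{k*}` of a member of a covering. -/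
def starSet {X J : Type*} (P : J → Set X) (j : J) : ℕ → Set X
  | 0 => P j
  | k + 1 => ⋃ l ∈ {l | (P l ∩ starSet P j k).Nonempty}, P l

/-- `Q` is almost subordinate to `P`. -/
def AlmostSubordinate {X I J : Type*} (Q : I → Set X) (P : J → Set X) : Prop :=
  ∃ k : ℕ, ∀ i : I, ∃ j : J, Q i ⊆ starSet P j k

/-- Two coverings of the same set are equivalent if each is almost subordinate to the other. -/
def EquivalentCoverings {X I J : Type*} (Q : I → Set X) (P : J → Set X) : Prop :=
  AlmostSubordinate Q P ∧ AlmostSubordinate P Q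

/-- The word metric associated to a generating set `S` of a group. -/
noncomputable def wordDist {G : Type*} [Group G] (S : Set G) (g h : G) : ℝ :=
  ((sInf {n : ℕ | ∃ w : Fin n → G, (∀ i, w i ∈ S) ∧ g⁻¹ * h = (List.ofFn w).prod} : ℕ) : ℝ)

/-- The uniform covering of `ℝⁿ` by the integer translates of the unit cube. -/
def uniformCovering (n : ℕ) : (Fin n → ℤ) → Set (Fin n → ℝ) :=
  fun v => {x | ∀ i, (v i : ℝ) ≤ x i ∧ x i ≤ (v i : ℝ) + 1}

/-- The dyadic covering of `ℝⁿ` (with the Euclidean norm). -/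
def dyadicCovering (n : ℕ) : ℕ → Set (EuclideanSpace ℝ (Fin n)) :=
  fun m => if m = 0 then {x | ‖x‖ ≤ 2}
           else {x | (2 : ℝ) ^ (m - 1) ≤ ‖x‖ ∧ ‖x‖ ≤ (2 : ℝ) ^ (m + 1)}

theorem chainExists_of_seq {X I : Type*} {Q : I → Set X} {N : ℕ} {x y : X} (c : ℕ → I)
    (hx : x ∈ Q (c 0)) (hy : y ∈ Q (c N))
    (h : ∀ t < N, (Q (c t) ∩ Q (c (t + 1))).Nonempty) : ChainExists Q (N + 1) x y :=
  ⟨N.succ_pos, fun t => c t, hx, hy, fun t ht => h t (by omega)⟩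

/-- A function with oscillation at most `a` on each member of a covering changes by at most
`a * k` along a chain of length `k`. -/
theorem ChainExists.abs_sub_le {X I : Type*} {Q : I → Set X} {φ : X → ℝ} {a : ℝ}
    (hφ : ∀ i, ∀ x ∈ Q i, ∀ y ∈ Q i, |φ x - φ y| ≤ a) {k : ℕ} {x y : X}
    (h : ChainExists Q k x y) : |φ x - φ y| ≤ a * k := by
  obtain ⟨hk, c, hx, hy, hc⟩ := h
  have key : ∀ (t : ℕ) (ht : t < k), ∀ z ∈ Q (c ⟨t, ht⟩), |φ x - φ z| ≤ a * (t + 1 : ℕ) := by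
    intro t
    induction t with
    | zero => intro ht z hz; simpa using hφ _ x hx z hz
    | succ t ih =>
      intro ht z hz
      obtain ⟨w, hw₁, hw₂⟩ := hc t ht
      calc |φ x - φ z| ≤ |φ x - φ w| + |φ w - φ z| := _root_.abs_sub_le _ _ _
        _ ≤ a * (t + 1 : ℕ) + a := add_le_add (ih _ w hw₁) (hφ _ w hw₂ z hz)
        _ = a * (t + 1 + 1 : ℕ) := by push_cast; ring
  simpa [Nat.sub_add_cancel hk] using key (k - 1) (by omega) y hy

theorem coveredDist_le {X I : Type*} {Q : I → Set X} {k : ℕ} {x y : X}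
    (h : ChainExists Q k x y) : coveredDist Q x y ≤ k := by
  unfold coveredDist
  split_ifs
  · positivity
  · exact_mod_cast Nat.sInf_le h

theorem abs_sub_le_mul_coveredDist {X I : Type*} {Q : I → Set X} {φ : X → ℝ} {a : ℝ}
    (hφ : ∀ i, ∀ x ∈ Q i, ∀ y ∈ Q i, |φ x - φ y| ≤ a) {k : ℕ} {x y : X}
    (h : ChainExists Q k x y) : |φ x - φ y| ≤ a * coveredDist Q x y := by
  unfold coveredDist
  split_ifs with hxy
  · simp [hxy]
  · exact ChainExists.abs_sub_le hφ (Nat.sInf_mem (s := {k | ChainExists Q k x y}) ⟨k, h⟩)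

theorem chainExists_uniformCovering_const (n : ℕ) (k : ℤ) (N : ℕ) :
    ChainExists (uniformCovering n) (N + 1) (fun _ => (k : ℝ)) (fun _ => ((k + N : ℤ) : ℝ)) := by
  refine chainExists_of_seq (fun t _ => k + t) ?_ ?_ fun t _ =>
    ⟨fun _ => (k + t + 1 : ℝ), fun i => ?_, fun i => ?_⟩
  · simp [uniformCovering]
  · simp [uniformCovering]
  · simp
  · push_cast
    constructor <;> linarith

theorem coveredDist_uniformCovering_const_succ_le (n : ℕ) (k : ℤ) :
    coveredDist (uniformCovering n) (fun _ => (k : ℝ)) (fun _ => ((k + 1 : ℤ) : ℝ)) ≤ 1 := by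
  have h : ChainExists (uniformCovering n) 1 (fun _ => (k : ℝ)) (fun _ => ((k + 1 : ℤ) : ℝ)) :=
    chainExists_of_seq (N := 0) (fun _ _ => k) (by simp [uniformCovering])
      (by simp [uniformCovering]) (by simp)
  simpa using coveredDist_le h

theorem sub_le_coveredDist_uniformCovering_const {n : ℕ} (hn : 1 ≤ n) {k m : ℤ} (hkm : k ≤ m) :
    (m - k : ℝ) ≤ coveredDist (uniformCovering n) (fun _ => (k : ℝ)) (fun _ => (m : ℝ)) := by
  obtain ⟨N, rfl⟩ := Int.le.dest hkm
  have h := abs_sub_le_mul_coveredDist (φ := fun x : Fin n → ℝ => x ⟨0, hn⟩) (a := 1)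
    (fun v x hx y hy => by
      have := hx ⟨0, hn⟩
      have := hy ⟨0, hn⟩
      rw [abs_le]
      constructor <;> linarith) (chainExists_uniformCovering_const n k N)
  rw [one_mul] at h
  exact (neg_sub (k : ℝ) _ ▸ neg_le_abs _).trans h

/-- The index of a member of the dyadic covering containing `x`. -/
noncomputable def dyadicIndex {l : ℕ} (x : EuclideanSpace ℝ (Fin l)) : ℕ := Nat.log 2 ⌊‖x‖⌋₊

theorem mem_dyadicCovering_dyadicIndex {l : ℕ} (x : EuclideanSpace ℝ (Fin l)) :
    x ∈ dyadicCovering l (dyadicIndex x) := by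
  have hlt : ‖x‖ ≤ 2 ^ (dyadicIndex x + 1) := by
    have h : ⌊‖x‖⌋₊ + 1 ≤ 2 ^ (dyadicIndex x + 1) := Nat.lt_pow_succ_log_self one_lt_two _
    exact (Nat.lt_floor_add_one ‖x‖).le.trans (by exact_mod_cast h)
  unfold dyadicCovering
  split_ifs with h0
  · simpa [h0] using hlt
  · refine ⟨?_, hlt⟩
    have hne : ⌊‖x‖⌋₊ ≠ 0 := fun h => h0 (by simp [dyadicIndex, h])
    have h : 2 ^ (dyadicIndex x - 1) ≤ ⌊‖x‖⌋₊ :=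
      (Nat.pow_le_pow_right two_pos (Nat.sub_le _ _)).trans (Nat.pow_log_le_self 2 hne)
    calc (2 : ℝ) ^ (dyadicIndex x - 1) ≤ (⌊‖x‖⌋₊ : ℝ) := by exact_mod_cast h
      _ ≤ ‖x‖ := Nat.floor_le (norm_nonneg x)

theorem dyadicIndex_mem_Icc {l m : ℕ} {x : EuclideanSpace ℝ (Fin l)}
    (hx : x ∈ dyadicCovering l m) : m - 1 ≤ dyadicIndex x ∧ dyadicIndex x ≤ m + 1 := by
  have hle : ‖x‖ ≤ 2 ^ (m + 1) → dyadicIndex x ≤ m + 1 := fun h => by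
    have h' : ⌊‖x‖⌋₊ ≤ 2 ^ (m + 1) := Nat.floor_le_of_le (by exact_mod_cast h)
    simpa [dyadicIndex, Nat.log_pow] using Nat.log_mono_right (b := 2) h'
  unfold dyadicCovering at hx
  split_ifs at hx with h0
  · subst h0
    exact ⟨by simp, hle (by simpa using hx)⟩
  · refine ⟨?_, hle hx.2⟩
    have h' : 2 ^ (m - 1) ≤ ⌊‖x‖⌋₊ := Nat.le_floor (by exact_mod_cast hx.1)
    simpa [dyadicIndex, Nat.log_pow] using Nat.log_mono_right (b := 2) h'

theorem dyadicCovering_inter_succ_nonempty {l : ℕ} (hl : 1 ≤ l) (m : ℕ) :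
    (dyadicCovering l m ∩ dyadicCovering l (m + 1)).Nonempty := by
  have hnorm : ‖EuclideanSpace.single (⟨0, hl⟩ : Fin l) ((2 : ℝ) ^ (m + 1))‖ = 2 ^ (m + 1) := by
    simp
  refine ⟨EuclideanSpace.single ⟨0, hl⟩ (2 ^ (m + 1)), ?_, ?_⟩
  · unfold dyadicCovering
    split_ifs with h0
    · rw [mem_ofPred_eq, hnorm, h0]; norm_num
    · rw [mem_ofPred_eq, hnorm]
      exact ⟨pow_le_pow_right₀ one_le_two (by omega), le_rfl⟩
  · rw [dyadicCovering, if_neg m.succ_ne_zero, mem_ofPred_eq, hnorm]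
    exact ⟨pow_le_pow_right₀ one_le_two (by omega), pow_le_pow_right₀ one_le_two (by omega)⟩

theorem exists_chainExists_dyadicCovering {l : ℕ} (hl : 1 ≤ l) (x y : EuclideanSpace ℝ (Fin l)) :
    ∃ k : ℕ, ChainExists (dyadicCovering l) k x y ∧
      (k : ℝ) = |(dyadicIndex x : ℝ) - dyadicIndex y| + 1 := by
  have hx := mem_dyadicCovering_dyadicIndex x
  have hy := mem_dyadicCovering_dyadicIndex y
  rcases le_total (dyadicIndex x) (dyadicIndex y) with h | h
  · refine ⟨dyadicIndex y - dyadicIndex x + 1,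
      chainExists_of_seq (fun t => dyadicIndex x + t) hx (by simpa [h] using hy)
        fun t _ => dyadicCovering_inter_succ_nonempty hl _, ?_⟩
    have h' : (dyadicIndex x : ℝ) ≤ dyadicIndex y := by exact_mod_cast h
    rw [abs_of_nonpos (by linarith)]
    push_cast [Nat.cast_sub h]
    ring
  · refine ⟨dyadicIndex x - dyadicIndex y + 1,
      chainExists_of_seq (fun t => dyadicIndex x - t) hx (by simpa [Nat.sub_sub_self h] using hy)
        fun t ht => ?_, ?_⟩
    · obtain ⟨s, hs⟩ : ∃ s, dyadicIndex x - t = s + 1 := ⟨dyadicIndex x - t - 1, by omega⟩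
      have hs' : dyadicIndex x - (t + 1) = s := by omega
      simp only [hs, hs']
      rw [inter_comm]
      exact dyadicCovering_inter_succ_nonempty hl s
    · have h' : (dyadicIndex y : ℝ) ≤ dyadicIndex x := by exact_mod_cast h
      rw [abs_of_nonneg (by linarith)]
      push_cast [Nat.cast_sub h]
      ring

theorem abs_dyadicIndex_sub_le {l : ℕ} (hl : 1 ≤ l) (x y : EuclideanSpace ℝ (Fin l)) :
    |(dyadicIndex x : ℝ) - dyadicIndex y| ≤ 2 * coveredDist (dyadicCovering l) x y := by
  obtain ⟨k, hk, -⟩ := exists_chainExists_dyadicCovering hl x y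
  refine abs_sub_le_mul_coveredDist (φ := fun x => (dyadicIndex x : ℝ)) (fun m x hx y hy => ?_) hk
  have h₁ := dyadicIndex_mem_Icc hx
  have h₂ := dyadicIndex_mem_Icc hy
  have h₃ : (dyadicIndex x : ℝ) ≤ dyadicIndex y + 2 := by
    exact_mod_cast (by omega : dyadicIndex x ≤ dyadicIndex y + 2)
  have h₄ : (dyadicIndex y : ℝ) ≤ dyadicIndex x + 2 := by
    exact_mod_cast (by omega : dyadicIndex y ≤ dyadicIndex x + 2)
  rw [abs_le]
  constructor <;> linarith

theorem coveredDist_dyadicCovering_le {l : ℕ} (hl : 1 ≤ l) (x y : EuclideanSpace ℝ (Fin l)) :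
    coveredDist (dyadicCovering l) x y ≤ |(dyadicIndex x : ℝ) - dyadicIndex y| + 1 := by
  obtain ⟨k, hk, hk'⟩ := exists_chainExists_dyadicCovering hl x y
  exact hk' ▸ coveredDist_le hk

/-- A nonnegative coarse embedding `g` of the integers into the line satisfies `g (-N) ≤ g N`
for large `N`, since otherwise `g` would cross the level `g N` on the negative half-line. -/
theorem apply_neg_le_of_coarse {g : ℤ → ℝ} {A B D : ℝ} (hg : ∀ k, 0 ≤ g k) (hA : 0 ≤ A)
    (hD : ∀ k, |g k - g (k + 1)| ≤ D) (hAB : ∀ k m : ℤ, k ≤ m → (m - k : ℝ) ≤ A * |g k - g m| + B)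
    {N : ℕ} (hN₀ : A * g 0 + B < N) (hN : A * D + B < N) : g (-N) ≤ g N := by
  have h0 : g 0 ≤ g N := by
    by_contra! h
    have h₁ := hAB 0 N (by positivity)
    have h₂ : |g 0 - g N| ≤ g 0 := by
      rw [abs_of_pos (by linarith)]
      linarith [hg N]
    have h₃ := mul_le_mul_of_nonneg_left h₂ hA
    push_cast at h₁
    linarith
  have key : ∀ m : ℕ, g (-m) ≤ g N := by
    intro m
    induction m with
    | zero => simpa using h0
    | succ m ih =>
      by_contra! h
      have h₁ := hAB (-m) N (by omega)
      have h₂ := hD (-(m + 1 : ℕ))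
      rw [show -((m + 1 : ℕ) : ℤ) + 1 = -m by push_cast; ring, abs_of_pos (by linarith)] at h₂
      rw [abs_of_nonpos (by linarith)] at h₁
      have h₃ : A * -(g (-m) - g N) ≤ A * D := mul_le_mul_of_nonneg_left (by linarith) hA
      have h₄ : (0 : ℝ) ≤ m := m.cast_nonneg
      push_cast at h₁
      linarith
  exact key N

theorem not_coarse_of_nonneg {g : ℤ → ℝ} {A B D : ℝ} (hg : ∀ k, 0 ≤ g k) (hA : 0 ≤ A)
    (hD : ∀ k, |g k - g (k + 1)| ≤ D)
    (hAB : ∀ k m : ℤ, k ≤ m → (m - k : ℝ) ≤ A * |g k - g m| + B) : False := by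
  obtain ⟨N, hN⟩ := exists_nat_gt (max (A * g 0 + B) (A * D + B))
  obtain ⟨hN₀, hN₁⟩ := max_lt_iff.1 hN
  have h₁ := apply_neg_le_of_coarse hg hA hD hAB hN₀ hN₁
  have h₂ := apply_neg_le_of_coarse (g := fun k => g (-k)) (fun k => hg _) hA
    (fun k => by
      rw [abs_sub_comm]
      simpa using hD (-(k + 1)))
    (fun k m hkm => by
      have := hAB (-m) (-k) (by omega)
      rw [abs_sub_comm] at this
      push_cast at this
      linarith) (by simpa using hN₀) hN₁
  simp only [neg_neg] at h₂
  have h₃ := hAB (-N) N (by omega)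
  rw [le_antisymm h₁ h₂, sub_self, abs_zero, mul_zero] at h₃
  have hD₀ : 0 ≤ A * D := mul_nonneg hA ((abs_nonneg _).trans (hD 0))
  have h₄ : (0 : ℝ) ≤ N := N.cast_nonneg
  push_cast at h₃
  linarith

/-- For all `n, l ≥ 1`, the metric spaces `(ℝⁿ, d_U)` (uniform covering) and
`(ℝˡ, d_{B(ℝˡ)})` (dyadic covering) are not quasi-isometric: there exists no quasi-isometry
from `(ℝⁿ, d_U)` to `(ℝˡ, d_{B(ℝˡ)})`. -/
theorem statement9 (n l : ℕ) (hn : 1 ≤ n) (hl : 1 ≤ l) :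
    ¬ ∃ f : (Fin n → ℝ) → EuclideanSpace ℝ (Fin l),
        IsQuasiIsometry (coveredDist (uniformCovering n)) (coveredDist (dyadicCovering l)) f := by
  rintro ⟨f, ⟨L, C, hL, -, hf⟩, -⟩
  refine not_coarse_of_nonneg (g := fun k : ℤ => (dyadicIndex (f fun _ => (k : ℝ)) : ℝ))
    (A := L) (B := L * (1 + C)) (D := 2 * (L * 1 + C)) (fun k => Nat.cast_nonneg _) hL.le
    (fun k => ?_) fun k m hkm => ?_
  · refine (abs_dyadicIndex_sub_le hl _ _).trans ?_
    have h₁ := (hf (fun _ => (k : ℝ)) fun _ => ((k + 1 : ℤ) : ℝ)).2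
    have h₂ := mul_le_mul_of_nonneg_left (coveredDist_uniformCovering_const_succ_le n k) hL.le
    linarith
  · have h₁ := (hf (fun _ => (k : ℝ)) fun _ => (m : ℝ)).1
    have h₂ := sub_le_coveredDist_uniformCovering_const hn hkm
    have h₃ := coveredDist_dyadicCovering_le hl (f fun _ => (k : ℝ)) (f fun _ => (m : ℝ))
    rw [← mul_add]
    refine h₂.trans ?_
    rw [← div_le_iff₀' hL, div_eq_inv_mul, ← one_div]
    linarith
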